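/- arXiv:2008.13356 — 3 statements merged into one kernel-verified Lean document; each statement's English description precedes it below -/
import Mathlib

section
/- If process expressions P and Q of the process algebra with global variables are stateless bisimilar, then for every valuation V and every HML^{check+set} formula φ, ⟨P,V⟩ satisfies φ if and only if ⟨Q,V⟩ satisfies φ. -/
namespace GlobalVars

open scoped Classical

/-! ## The process algebra with global variables -/

/-- Transition labels: actions and assignments `assign(v,d)`. -/
inductive Label (D Var Act : Type) : Type
  | act : Act → Label D Var Act
  | assign : Var → D → Label D Var Act

/-- Process expressions of the process algebra with global variables. -/
inductive PExp (D Var Act PN : Type) : Type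
  | pre : Label D Var Act → PExp D Var Act PN → PExp D Var Act PN
  | delta : PExp D Var Act PN
  | choice : PExp D Var Act PN → PExp D Var Act PN → PExp D Var Act PN
  | par : PExp D Var Act PN → PExp D Var Act PN → PExp D Var Act PN
  | encaps : Set Act → PExp D Var Act PN → PExp D Var Act PN
  | name : PN → PExp D Var Act PN
  | cond : Var → D → PExp D Var Act PN → PExp D Var Act PN

/-- Valuations of the global variables. -/
abbrev Valuation (D Var : Type) := Var → D

variable {D Var Act PN : Type}

/-- Every occurrence of a process name is in the scope of an action prefix. -/
def GuardedExp : PExp D Var Act PN → Prop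
  | .pre _ _ => True
  | .delta => True
  | .choice P Q => GuardedExp P ∧ GuardedExp Q
  | .par P Q => GuardedExp P ∧ GuardedExp Q
  | .encaps _ P => GuardedExp P
  | .name _ => False
  | .cond _ _ P => GuardedExp P

/-- A guarded recursive specification. -/
def Guarded (spec : PN → PExp D Var Act PN) : Prop := ∀ X, GuardedExp (spec X)

/-- A label is not blocked by the encapsulation set `B ⊆ Act`. -/
def Label.allowedBy (B : Set Act) : Label D Var Act → Prop
  | .act a => a ∉ B
  | .assign _ _ => True

/-- A partial binary communication function on actions. -/
def CommFun (Act : Type) : Type := Act → Act → Option Act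

/-- Commutativity of the communication function. -/
def CommFun.Commutative (γ : CommFun Act) : Prop := ∀ a b, γ a b = γ b a

/-- Associativity of the communication function. -/
def CommFun.Associative (γ : CommFun Act) : Prop :=
  ∀ a b c, (γ a b).bind (fun x => γ x c) = (γ b c).bind (fun x => γ a x)

/-- Only handshaking communication: results of communications do not communicate further. -/
def CommFun.Handshaking (γ : CommFun Act) : Prop :=
  ∀ a b c, γ a b = some c → ∀ d, γ c d = none

/-- The structural operational semantics of the process algebra with global variables. -/
inductive Trans [DecidableEq Var] (spec : PN → PExp D Var Act PN) (γ : CommFun Act) :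
    PExp D Var Act PN → Valuation D Var → Label D Var Act →
    PExp D Var Act PN → Valuation D Var → Prop
  | pref (a : Act) (P : PExp D Var Act PN) (V : Valuation D Var) :
      Trans spec γ (.pre (.act a) P) V (.act a) P V
  | asgn (v : Var) (d : D) (P : PExp D Var Act PN) (V : Valuation D Var) :
      Trans spec γ (.pre (.assign v d) P) V (.assign v d) P (Function.update V v d)
  | cond (v : Var) (d : D) (P : PExp D Var Act PN) (V : Valuation D Var) (l : Label D Var Act)
      (P' : PExp D Var Act PN) (V' : Valuation D Var) :
      V v = d → Trans spec γ P V l P' V' → Trans spec γ (.cond v d P) V l P' V'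
  | recursion (X : PN) (V : Valuation D Var) (l : Label D Var Act) (P' : PExp D Var Act PN)
      (V' : Valuation D Var) :
      Trans spec γ (spec X) V l P' V' → Trans spec γ (.name X) V l P' V'
  | sumL (P Q : PExp D Var Act PN) (V : Valuation D Var) (l : Label D Var Act)
      (P' : PExp D Var Act PN) (V' : Valuation D Var) :
      Trans spec γ P V l P' V' → Trans spec γ (.choice P Q) V l P' V'
  | sumR (P Q : PExp D Var Act PN) (V : Valuation D Var) (l : Label D Var Act)
      (Q' : PExp D Var Act PN) (V' : Valuation D Var) :
      Trans spec γ Q V l Q' V' → Trans spec γ (.choice P Q) V l Q' V'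
  | parL (P Q : PExp D Var Act PN) (V : Valuation D Var) (l : Label D Var Act)
      (P' : PExp D Var Act PN) (V' : Valuation D Var) :
      Trans spec γ P V l P' V' → Trans spec γ (.par P Q) V l (.par P' Q) V'
  | parR (P Q : PExp D Var Act PN) (V : Valuation D Var) (l : Label D Var Act)
      (Q' : PExp D Var Act PN) (V' : Valuation D Var) :
      Trans spec γ Q V l Q' V' → Trans spec γ (.par P Q) V l (.par P Q') V'
  | comm (P Q : PExp D Var Act PN) (V : Valuation D Var) (a b c : Act)
      (P' Q' : PExp D Var Act PN) :
      γ a b = some c → Trans spec γ P V (.act a) P' V → Trans spec γ Q V (.act b) Q' V →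
      Trans spec γ (.par P Q) V (.act c) (.par P' Q') V
  | encaps (B : Set Act) (P : PExp D Var Act PN) (V : Valuation D Var) (l : Label D Var Act)
      (P' : PExp D Var Act PN) (V' : Valuation D Var) :
      l.allowedBy B → Trans spec γ P V l P' V' →
      Trans spec γ (.encaps B P) V l (.encaps B P') V'

/-- States of the induced labelled transition system. -/
abbrev GState (D Var Act PN : Type) := PExp D Var Act PN × Valuation D Var

/-- The transition relation on states. -/
def STrans [DecidableEq Var] (spec : PN → PExp D Var Act PN) (γ : CommFun Act) :
    GState D Var Act PN → Label D Var Act → GState D Var Act PN → Prop :=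
  fun s l s' => Trans spec γ s.1 s.2 l s'.1 s'.2

/-! ## Bisimulations -/

/-- A strong bisimulation on an LTS with states `S` and labels `L`. -/
def IsBisim {S L : Type} (tr : S → L → S → Prop) (R : S → S → Prop) : Prop :=
  ∀ s t, R s t → ∀ l : L,
    (∀ s', tr s l s' → ∃ t', tr t l t' ∧ R s' t') ∧
    (∀ t', tr t l t' → ∃ s', tr s l s' ∧ R s' t')

/-- Strong bisimilarity. -/
def Bisimilar {S L : Type} (tr : S → L → S → Prop) (s t : S) : Prop :=
  ∃ R, IsBisim tr R ∧ R s t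

/-- A stateless bisimulation on process expressions. -/
def IsStatelessBisim [DecidableEq Var] (spec : PN → PExp D Var Act PN) (γ : CommFun Act)
    (R : PExp D Var Act PN → PExp D Var Act PN → Prop) : Prop :=
  ∀ P Q, R P Q → ∀ (l : Label D Var Act) (V V' : Valuation D Var),
    (∀ P', Trans spec γ P V l P' V' → ∃ Q', Trans spec γ Q V l Q' V' ∧ R P' Q') ∧
    (∀ Q', Trans spec γ Q V l Q' V' → ∃ P', Trans spec γ P V l P' V' ∧ R P' Q')

/-- Stateless bisimilarity of process expressions. -/
def StatelessBisimilar [DecidableEq Var] (spec : PN → PExp D Var Act PN) (γ : CommFun Act)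
    (P Q : PExp D Var Act PN) : Prop :=
  ∃ R, IsStatelessBisim spec γ R ∧ R P Q

/-- A state-based bisimulation on states. -/
def IsStateBasedBisim [DecidableEq Var] (spec : PN → PExp D Var Act PN) (γ : CommFun Act)
    (R : GState D Var Act PN → GState D Var Act PN → Prop) : Prop :=
  ∀ (P : PExp D Var Act PN) (V₁ : Valuation D Var) (Q : PExp D Var Act PN)
    (V₂ : Valuation D Var), R (P, V₁) (Q, V₂) →
    V₁ = V₂ ∧ ∀ (l : Label D Var Act) (V' : Valuation D Var),
      (∀ P', Trans spec γ P V₁ l P' V' →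
        ∃ Q', Trans spec γ Q V₂ l Q' V' ∧ R (P', V') (Q', V')) ∧
      (∀ Q', Trans spec γ Q V₂ l Q' V' →
        ∃ P', Trans spec γ P V₁ l P' V' ∧ R (P', V') (Q', V'))

/-- State-based bisimilarity of states. -/
def StateBasedBisimilar [DecidableEq Var] (spec : PN → PExp D Var Act PN) (γ : CommFun Act)
    (s t : GState D Var Act PN) : Prop :=
  ∃ R, IsStateBasedBisim spec γ R ∧ R s t

/-! ## Reachability and image-finiteness -/

/-- Reachability of states in an arbitrary LTS. -/
def ReachableState {S L : Type} (tr : S → L → S → Prop) : S → S → Prop :=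
  Relation.ReflTransGen (fun s s' => ∃ l, tr s l s')

/-- Reachability of process expressions (via transitions for some valuations). -/
def ReachableProc [DecidableEq Var] (spec : PN → PExp D Var Act PN) (γ : CommFun Act) :
    PExp D Var Act PN → PExp D Var Act PN → Prop :=
  Relation.ReflTransGen
    (fun P P' => ∃ (V : Valuation D Var) (l : Label D Var Act) (V' : Valuation D Var),
      Trans spec γ P V l P' V')

/-- Image-finiteness of a state of an arbitrary LTS. -/
def ImageFiniteState {S L : Type} (tr : S → L → S → Prop) (s : S) : Prop :=
  ∀ l : L, {s' | tr s l s'}.Finite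

/-- Image-finiteness of a process expression. -/
def ImageFiniteProc [DecidableEq Var] (spec : PN → PExp D Var Act PN) (γ : CommFun Act)
    (P : PExp D Var Act PN) : Prop :=
  ∀ P', ReachableProc spec γ P P' → ∀ V : Valuation D Var,
    ImageFiniteState (STrans spec γ) (P', V)

/-! ## Hennessy–Milner logics -/

/-- Plain Hennessy–Milner logic over a type `L` of transition labels
(the modalities carry nonempty finite sets of labels). -/
inductive HMLb (L : Type) : Type
  | tt : HMLb L
  | ff : HMLb L
  | neg : HMLb L → HMLb L
  | conj : HMLb L → HMLb L → HMLb L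
  | disj : HMLb L → HMLb L → HMLb L
  | dia : (T : Set L) → T.Finite → T.Nonempty → HMLb L → HMLb L
  | box : (T : Set L) → T.Finite → T.Nonempty → HMLb L → HMLb L

/-- Satisfaction of plain HML in a state of an LTS. -/
def HMLb.Sat {S L : Type} (tr : S → L → S → Prop) : HMLb L → S → Prop
  | .tt, _ => True
  | .ff, _ => False
  | .neg φ, s => ¬ HMLb.Sat tr φ s
  | .conj φ ψ, s => HMLb.Sat tr φ s ∧ HMLb.Sat tr ψ s
  | .disj φ ψ, s => HMLb.Sat tr φ s ∨ HMLb.Sat tr ψ s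
  | .dia T _ _ φ, s => ∃ l ∈ T, ∃ s', tr s l s' ∧ HMLb.Sat tr φ s'
  | .box T _ _ φ, s => ∀ l ∈ T, ∀ s', tr s l s' → HMLb.Sat tr φ s'

/-- `HML^{check}`: HML extended with the check operator `(v = e)`. -/
inductive HMLc (D Var L : Type) : Type
  | tt : HMLc D Var L
  | ff : HMLc D Var L
  | check : Var → D → HMLc D Var L
  | neg : HMLc D Var L → HMLc D Var L
  | conj : HMLc D Var L → HMLc D Var L → HMLc D Var L
  | disj : HMLc D Var L → HMLc D Var L → HMLc D Var L
  | dia : (T : Set L) → T.Finite → T.Nonempty → HMLc D Var L → HMLc D Var L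
  | box : (T : Set L) → T.Finite → T.Nonempty → HMLc D Var L → HMLc D Var L

/-- Satisfaction of `HML^{check}` in a state consisting of a process and a valuation. -/
def HMLc.Sat {Pr L : Type}
    (tr : (Pr × Valuation D Var) → L → (Pr × Valuation D Var) → Prop) :
    HMLc D Var L → (Pr × Valuation D Var) → Prop
  | .tt, _ => True
  | .ff, _ => False
  | .check v e, s => s.2 v = e
  | .neg φ, s => ¬ HMLc.Sat tr φ s
  | .conj φ ψ, s => HMLc.Sat tr φ s ∧ HMLc.Sat tr ψ s
  | .disj φ ψ, s => HMLc.Sat tr φ s ∨ HMLc.Sat tr ψ s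
  | .dia T _ _ φ, s => ∃ l ∈ T, ∃ s', tr s l s' ∧ HMLc.Sat tr φ s'
  | .box T _ _ φ, s => ∀ l ∈ T, ∀ s', tr s l s' → HMLc.Sat tr φ s'

/-- `HML^{check+set}`: HML extended with the check operator `(v = e)` and the
set operator `↓(v := e)`. -/
inductive HMLcs (D Var L : Type) : Type
  | tt : HMLcs D Var L
  | ff : HMLcs D Var L
  | check : Var → D → HMLcs D Var L
  | neg : HMLcs D Var L → HMLcs D Var L
  | conj : HMLcs D Var L → HMLcs D Var L → HMLcs D Var L
  | disj : HMLcs D Var L → HMLcs D Var L → HMLcs D Var L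
  | dia : (T : Set L) → T.Finite → T.Nonempty → HMLcs D Var L → HMLcs D Var L
  | box : (T : Set L) → T.Finite → T.Nonempty → HMLcs D Var L → HMLcs D Var L
  | set : Var → D → HMLcs D Var L → HMLcs D Var L

/-- Satisfaction of `HML^{check+set}` in a state consisting of a process and a valuation. -/
def HMLcs.Sat {Pr L : Type} [DecidableEq Var]
    (tr : (Pr × Valuation D Var) → L → (Pr × Valuation D Var) → Prop) :
    HMLcs D Var L → (Pr × Valuation D Var) → Prop
  | .tt, _ => True
  | .ff, _ => False
  | .check v e, s => s.2 v = e
  | .neg φ, s => ¬ HMLcs.Sat tr φ s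
  | .conj φ ψ, s => HMLcs.Sat tr φ s ∧ HMLcs.Sat tr ψ s
  | .disj φ ψ, s => HMLcs.Sat tr φ s ∨ HMLcs.Sat tr ψ s
  | .dia T _ _ φ, s => ∃ l ∈ T, ∃ s', tr s l s' ∧ HMLcs.Sat tr φ s'
  | .box T _ _ φ, s => ∀ l ∈ T, ∀ s', tr s l s' → HMLcs.Sat tr φ s'
  | .set v e φ, s => HMLcs.Sat tr φ (s.1, Function.update s.2 v e)

/-! ## The mCRL2 fragment -/

/-- Action labels of the mCRL2 fragment used for the translation. -/
inductive MAct (D Var Act : Type) : Type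
  | act : Act → MAct D Var Act
  | checkP : D → Bool → MAct D Var Act
  | checkG : D → Bool → MAct D Var Act
  | check : D → Bool → MAct D Var Act
  | assignP : Var → D → MAct D Var Act
  | assignG : Var → D → MAct D Var Act
  | assign : Var → D → MAct D Var Act
  | value : Var → D → MAct D Var Act

/-- Action names of the mCRL2 fragment. -/
inductive MName (Act : Type) : Type
  | act : Act → MName Act
  | checkP : MName Act
  | checkG : MName Act
  | check : MName Act
  | assignP : MName Act
  | assignG : MName Act
  | assign : MName Act
  | value : MName Act

/-- The name of an action label. -/
def MAct.name : MAct D Var Act → MName Act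
  | .act a => .act a
  | .checkP _ _ => .checkP
  | .checkG _ _ => .checkG
  | .check _ _ => .check
  | .assignP _ _ => .assignP
  | .assignG _ _ => .assignG
  | .assign _ _ => .assign
  | .value _ _ => .value

/-- mCRL2 process expressions of the fragment needed for the translation.
Multi-action prefixes carry semantic multi-actions (finite multisets of action labels);
`comm` is the communication operator `Γ_{C_{Gγ}}`. -/
inductive MProc (D Var Act N : Type) : Type
  | pre : Multiset (MAct D Var Act) → MProc D Var Act N → MProc D Var Act N
  | delta : MProc D Var Act N
  | choice : MProc D Var Act N → MProc D Var Act N → MProc D Var Act N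
  | par : MProc D Var Act N → MProc D Var Act N → MProc D Var Act N
  | allow : Set (Multiset (MName Act)) → MProc D Var Act N → MProc D Var Act N
  | name : N → MProc D Var Act N
  | sum : (D → MProc D Var Act N) → MProc D Var Act N
  | hide : Set (MName Act) → MProc D Var Act N → MProc D Var Act N
  | comm : MProc D Var Act N → MProc D Var Act N

/-- The effect of hiding the action names in `I` on a semantic multi-action. -/
noncomputable def hideM (I : Set (MName Act)) (α : Multiset (MAct D Var Act)) :
    Multiset (MAct D Var Act) :=
  α.filter (fun a => a.name ∉ I)

/-- A single application of one of the communications in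
`C_{Gγ} = C_γ ∪ {assignP|assignG → assign, checkP|checkG → check}` to a semantic
multi-action (data parameters must match). -/
inductive CommStep (γ : CommFun Act) :
    Multiset (MAct D Var Act) → Multiset (MAct D Var Act) → Prop
  | act (a b c : Act) (rest : Multiset (MAct D Var Act)) : γ a b = some c →
      CommStep γ (MAct.act a ::ₘ MAct.act b ::ₘ rest) (MAct.act c ::ₘ rest)
  | assign (v : Var) (d : D) (rest : Multiset (MAct D Var Act)) :
      CommStep γ (MAct.assignP v d ::ₘ MAct.assignG v d ::ₘ rest) (MAct.assign v d ::ₘ rest)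
  | check (d : D) (b : Bool) (rest : Multiset (MAct D Var Act)) :
      CommStep γ (MAct.checkP d b ::ₘ MAct.checkG d b ::ₘ rest) (MAct.check d b ::ₘ rest)

/-- `γ_{C_{Gγ}}(α) = β`: the communications are applied exhaustively to `α`, yielding `β`. -/
def CommApply (γ : CommFun Act) (α β : Multiset (MAct D Var Act)) : Prop :=
  Relation.ReflTransGen (CommStep γ) α β ∧ ∀ β', ¬ CommStep γ β β'

/-- The structural operational semantics of the mCRL2 fragment, for a recursive
specification `mspec` assigning a defining process to every (parametrized) process name. -/
inductive MTrans {N : Type} (mspec : N → MProc D Var Act N) (γ : CommFun Act) :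
    MProc D Var Act N → Multiset (MAct D Var Act) → MProc D Var Act N → Prop
  | pre (α : Multiset (MAct D Var Act)) (P : MProc D Var Act N) :
      MTrans mspec γ (.pre α P) α P
  | sumL (P Q P' : MProc D Var Act N) (α : Multiset (MAct D Var Act)) :
      MTrans mspec γ P α P' → MTrans mspec γ (.choice P Q) α P'
  | sumR (P Q Q' : MProc D Var Act N) (α : Multiset (MAct D Var Act)) :
      MTrans mspec γ Q α Q' → MTrans mspec γ (.choice P Q) α Q'
  | name (n : N) (α : Multiset (MAct D Var Act)) (P' : MProc D Var Act N) :
      MTrans mspec γ (mspec n) α P' → MTrans mspec γ (.name n) α P'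
  | parL (P Q P' : MProc D Var Act N) (α : Multiset (MAct D Var Act)) :
      MTrans mspec γ P α P' → MTrans mspec γ (.par P Q) α (.par P' Q)
  | parR (P Q Q' : MProc D Var Act N) (α : Multiset (MAct D Var Act)) :
      MTrans mspec γ Q α Q' → MTrans mspec γ (.par P Q) α (.par P Q')
  | parC (P Q P' Q' : MProc D Var Act N) (α β : Multiset (MAct D Var Act)) :
      MTrans mspec γ P α P' → MTrans mspec γ Q β Q' →
      MTrans mspec γ (.par P Q) (α + β) (.par P' Q')
  | sum (f : D → MProc D Var Act N) (d : D) (α : Multiset (MAct D Var Act))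
      (P' : MProc D Var Act N) :
      MTrans mspec γ (f d) α P' → MTrans mspec γ (.sum f) α P'
  | hide (I : Set (MName Act)) (P P' : MProc D Var Act N) (α : Multiset (MAct D Var Act)) :
      MTrans mspec γ P α P' → MTrans mspec γ (.hide I P) (hideM I α) (.hide I P')
  | comm (P P' : MProc D Var Act N) (α β : Multiset (MAct D Var Act)) :
      MTrans mspec γ P α P' → CommApply γ α β → MTrans mspec γ (.comm P) β (.comm P')
  | allow (M : Set (Multiset (MName Act))) (P P' : MProc D Var Act N)
      (α : Multiset (MAct D Var Act)) :
      MTrans mspec γ P α P' → α.map MAct.name ∈ M →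
      MTrans mspec γ (.allow M P) α (.allow M P')

/-! ## Sequential and parallel-sequential process expressions, and the translation -/

/-- Sequential process expressions (the domain of the translation `χ`). -/
inductive SeqExp (D Var Act PN : Type) : Type
  | choice : SeqExp D Var Act PN → SeqExp D Var Act PN → SeqExp D Var Act PN
  | cond : Var → D → SeqExp D Var Act PN → SeqExp D Var Act PN
  | pre : Label D Var Act → SeqExp D Var Act PN → SeqExp D Var Act PN
  | delta : SeqExp D Var Act PN
  | name : PN → SeqExp D Var Act PN

/-- Parallel-sequential process expressions. -/
inductive ParExp (D Var Act PN : Type) : Type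
  | par : ParExp D Var Act PN → ParExp D Var Act PN → ParExp D Var Act PN
  | name : PN → ParExp D Var Act PN
  | seq : SeqExp D Var Act PN → ParExp D Var Act PN

/-- The embedding of sequential expressions into process expressions. -/
def SeqExp.toPExp : SeqExp D Var Act PN → PExp D Var Act PN
  | .choice P Q => .choice P.toPExp Q.toPExp
  | .cond v d P => .cond v d P.toPExp
  | .pre l P => .pre l P.toPExp
  | .delta => .delta
  | .name X => .name X

/-- The embedding of parallel-sequential expressions into process expressions. -/
def ParExp.toPExp : ParExp D Var Act PN → PExp D Var Act PN
  | .par P Q => .par P.toPExp Q.toPExp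
  | .name X => .name X
  | .seq P => P.toPExp

/-- The translation `χ` of sequential process expressions (over the single global
variable `g`, whence `Var = Unit`), parametrized by a finite set `ε ⊆ D` of constraints. -/
def chi [DecidableEq D] : SeqExp D Unit Act PN → Finset D → MProc D Unit Act (PN ⊕ D)
  | .choice P₁ P₂, ε => .choice (chi P₁ ε) (chi P₂ ε)
  | .cond _ d P₁, ε => chi P₁ (insert d ε)
  | .pre (.act a) P₁, ε => .sum (fun d₁ =>
      .pre {MAct.act a, MAct.checkP d₁ (decide (∀ d ∈ ε, d₁ = d))} (chi P₁ ∅))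
  | .pre (.assign v d') P₁, ε => .sum (fun d₁ =>
      .pre {MAct.assignP v d', MAct.checkP d₁ (decide (∀ d ∈ ε, d₁ = d))} (chi P₁ ∅))
  | .delta, _ => .delta
  | .name X, _ => .name (Sum.inl X)

/-- The defining body of the process `Globs(d : D)` tracking the global variable `g`. -/
def GlobsBody (d : D) : MProc D Unit Act (PN ⊕ D) :=
  .choice (.choice (.choice
    (.pre {MAct.checkG d true} (.name (Sum.inr d)))
    (.pre {MAct.checkG d true, MAct.checkG d true} (.name (Sum.inr d))))
    (.sum (fun new => .pre {MAct.checkG d true, MAct.assignG () new} (.name (Sum.inr new)))))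
    (.pre {MAct.value () d} (.name (Sum.inr d)))

/-- The translated recursive specification `E'`: the translation of the defining equation
for every process name of `E`, together with a defining equation for `Globs`. -/
def mspec [DecidableEq D] (spec : PN → SeqExp D Unit Act PN) :
    PN ⊕ D → MProc D Unit Act (PN ⊕ D)
  | Sum.inl X => chi (spec X) ∅
  | Sum.inr d => GlobsBody d

/-- The extension of `χ` to parallel-sequential process expressions. -/
def chiPar [DecidableEq D] : ParExp D Unit Act PN → MProc D Unit Act (PN ⊕ D)
  | .par P₁ P₂ => .par (chiPar P₁) (chiPar P₂)
  | .name X => .name (Sum.inl X)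
  | .seq P => chi P ∅

/-- The set `A_B = (Act ∖ B) ∪ {value, assign}` of allowed multi-action names. -/
def allowSet (B : Set Act) : Set (Multiset (MName Act)) :=
  {m | (∃ a : Act, a ∉ B ∧ m = {MName.act a}) ∨ m = {MName.assign} ∨ m = {MName.value}}

/-- The translation `Ψ(P,V) = ∇_{A_B}(τ_{{check}}(Γ_{C_{Gγ}}(χ(P,∅) ∥ Globs(V(g)))))`. -/
def Psi [DecidableEq D] (B : Set Act) (P : ParExp D Unit Act PN) (V : Valuation D Unit) :
    MProc D Unit Act (PN ⊕ D) :=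
  .allow (allowSet B) (.hide {MName.check} (.comm (.par (chiPar P) (.name (Sum.inr (V ()))))))

/-- The embedding of the transition labels `TL` as semantic multi-actions. -/
def labelToM : Label D Var Act → Multiset (MAct D Var Act)
  | .act a => {MAct.act a}
  | .assign v d => {MAct.assign v d}

/-! ## Variable consistency and translation of formulas -/

/-- Variable consistency of an LTS `(S₂, →₂, s₂)` over mCRL2 process expressions with an
LTS `(S₁, →₁, s₁)` whose states are pairs of a process expression and a valuation,
via a mapping `ℓ : S₁ → S₂`. -/
structure VarConsistent {Pr S₂ : Type}
    (tr₁ : (Pr × Valuation D Var) → Label D Var Act → (Pr × Valuation D Var) → Prop)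
    (s₁ : Pr × Valuation D Var)
    (tr₂ : S₂ → Multiset (MAct D Var Act) → S₂ → Prop) (s₂ : S₂)
    (ℓ : (Pr × Valuation D Var) → S₂) : Prop where
  map_reach : ∀ s₁', ReachableState tr₁ s₁ s₁' → ReachableState tr₂ (ℓ s₁) (ℓ s₁')
  labels : ∀ t₁ t₂ (α : Multiset (MAct D Var Act)),
    ReachableState tr₂ s₂ t₁ → ReachableState tr₂ s₂ t₂ → tr₂ t₁ α t₂ →
    (∃ l : Label D Var Act, α = labelToM l) ∨ (∃ (v : Var) (d : D), α = {MAct.value v d})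
  value_loops : ∀ (P : Pr) (V : Valuation D Var) (s' : S₂) (v : Var) (d : D),
    tr₂ (ℓ (P, V)) {MAct.value v d} s' ↔ (V v = d ∧ s' = ℓ (P, V))
  steps : ∀ (l : Label D Var Act) (s₁' s₂' : Pr × Valuation D Var),
    ReachableState tr₁ s₁ s₁' → ReachableState tr₁ s₁ s₂' →
    (tr₁ s₁' l s₂' ↔ tr₂ (ℓ s₁') (labelToM l) (ℓ s₂'))

/-- The translation `θ` of `HML^{check}` formulas into plain HML formulas: every check
`(v = e)` is replaced by `⟨value(v,e)⟩ true`. -/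
def theta {L L' : Type} (f : L → L') (valL : Var → D → L') : HMLc D Var L → HMLb L'
  | .tt => .tt
  | .ff => .ff
  | .check v e => .dia {valL v e} (Set.finite_singleton _) (Set.singleton_nonempty _) .tt
  | .neg φ => .neg (theta f valL φ)
  | .conj φ ψ => .conj (theta f valL φ) (theta f valL ψ)
  | .disj φ ψ => .disj (theta f valL φ) (theta f valL ψ)
  | .dia T hf hn φ => .dia (f '' T) (hf.image f) (hn.image f) (theta f valL φ)
  | .box T hf hn φ => .box (f '' T) (hf.image f) (hn.image f) (theta f valL φ)

/-- Processes related by a stateless bisimulation satisfy the same `HML^{check+set}` formulas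
under every valuation. -/
theorem IsStatelessBisim.sat_iff [DecidableEq Var] {spec : PN → PExp D Var Act PN}
    {γ : CommFun Act} {R : PExp D Var Act PN → PExp D Var Act PN → Prop}
    (hR : IsStatelessBisim spec γ R) (φ : HMLcs D Var (Label D Var Act))
    {P Q : PExp D Var Act PN} (hPQ : R P Q) (V : Valuation D Var) :
    HMLcs.Sat (STrans spec γ) φ (P, V) ↔ HMLcs.Sat (STrans spec γ) φ (Q, V) := by
  induction φ generalizing P Q V with
  | tt => exact Iff.rfl
  | ff => exact Iff.rfl
  | check v e => exact Iff.rfl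
  | neg φ ih => exact not_congr (ih hPQ V)
  | conj φ ψ ihφ ihψ => exact and_congr (ihφ hPQ V) (ihψ hPQ V)
  | disj φ ψ ihφ ihψ => exact or_congr (ihφ hPQ V) (ihψ hPQ V)
  | dia T _ _ φ ih =>
    constructor
    · rintro ⟨l, hl, ⟨P', V'⟩, hstep, hsat⟩
      obtain ⟨Q', hstep', hR'⟩ := (hR P Q hPQ l V V').1 P' hstep
      exact ⟨l, hl, (Q', V'), hstep', (ih hR' V').1 hsat⟩
    · rintro ⟨l, hl, ⟨Q', V'⟩, hstep, hsat⟩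
      obtain ⟨P', hstep', hR'⟩ := (hR P Q hPQ l V V').2 Q' hstep
      exact ⟨l, hl, (P', V'), hstep', (ih hR' V').2 hsat⟩
  | box T _ _ φ ih =>
    constructor
    · rintro h l hl ⟨Q', V'⟩ hstep
      obtain ⟨P', hstep', hR'⟩ := (hR P Q hPQ l V V').2 Q' hstep
      exact (ih hR' V').1 (h l hl (P', V') hstep')
    · rintro h l hl ⟨P', V'⟩ hstep
      obtain ⟨Q', hstep', hR'⟩ := (hR P Q hPQ l V V').1 P' hstep
      exact (ih hR' V').2 (h l hl (Q', V') hstep')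
  | set v e φ ih => exact ih hPQ (Function.update V v e)

/-- If `P` and `Q` are stateless bisimilar, then for every valuation `V` and every
`HML^{check+set}` formula `φ`, `⟨P,V⟩ ⊨ φ ↔ ⟨Q,V⟩ ⊨ φ`. -/
theorem statement2 {D Var Act PN : Type} [DecidableEq Var] [Finite Var]
    (spec : PN → PExp D Var Act PN) (hspec : Guarded spec)
    (γ : CommFun Act) (hγc : CommFun.Commutative γ) (hγa : CommFun.Associative γ)
    (hγh : CommFun.Handshaking γ)
    (P Q : PExp D Var Act PN)
    (h : StatelessBisimilar spec γ P Q) :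
    ∀ (V : Valuation D Var) (φ : HMLcs D Var (Label D Var Act)),
      HMLcs.Sat (STrans spec γ) φ (P, V) ↔ HMLcs.Sat (STrans spec γ) φ (Q, V) := by
  intro V φ
  obtain ⟨R, hR, hPQ⟩ := h
  exact hR.sat_iff φ hPQ V

end GlobalVars
end

section
/- The relation R = {(T,U) | T,U process expressions such that for all valuations V, ⟨T,V⟩ and ⟨U,V⟩ satisfy the same HML^{check+set} formulas} is, when restricted to image-finite process expressions, a stateless bisimulation relation; consequently, if image-finite process expressions P and Q satisfy the same HML^{check+set} formulas under every valuation, then P and Q are stateless bisimilar. -/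
namespace GlobalVars

open scoped Classical

variable {D Var Act PN : Type}

/-- A state satisfies the conjunction of `φ i` over a finite set `A` iff it satisfies each `φ i`. -/
theorem HMLcs.exists_conj {D Var Pr L ι : Type} [DecidableEq Var]
    (tr : (Pr × Valuation D Var) → L → (Pr × Valuation D Var) → Prop)
    (φ : ι → HMLcs D Var L) {A : Set ι} (hA : A.Finite) :
    ∃ ψ : HMLcs D Var L, ∀ s, HMLcs.Sat tr ψ s ↔ ∀ i ∈ A, HMLcs.Sat tr (φ i) s := by
  induction A, hA using Set.Finite.induction_on with
  | empty => exact ⟨.tt, fun s => by simp [HMLcs.Sat]⟩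
  | @insert a A _ _ ih =>
    obtain ⟨ψ, hψ⟩ := ih
    exact ⟨.conj (φ a) ψ, fun s => by simp [HMLcs.Sat, hψ]⟩

/-- With finitely many variables, iterated set operators can install any valuation `W`. -/
theorem HMLcs.exists_setAll {D Var Pr L : Type} [DecidableEq Var] [Finite Var]
    (tr : (Pr × Valuation D Var) → L → (Pr × Valuation D Var) → Prop)
    (W : Valuation D Var) (φ : HMLcs D Var L) :
    ∃ ψ : HMLcs D Var L, ∀ P V, HMLcs.Sat tr ψ (P, V) ↔ HMLcs.Sat tr φ (P, W) := by
  suffices h : ∀ A : Set Var, A.Finite → ∃ ψ : HMLcs D Var L, ∀ P V, (∀ v ∉ A, V v = W v) →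
      (HMLcs.Sat tr ψ (P, V) ↔ HMLcs.Sat tr φ (P, W)) by
    obtain ⟨ψ, hψ⟩ := h Set.univ Set.finite_univ
    exact ⟨ψ, fun P V => hψ P V (by simp)⟩
  intro A hA
  induction A, hA using Set.Finite.induction_on with
  | empty =>
    refine ⟨φ, fun P V hV => ?_⟩
    rw [show V = W from funext fun v => hV v (by simp)]
  | @insert a A _ _ ih =>
    obtain ⟨ψ, hψ⟩ := ih
    refine ⟨.set a (W a) ψ, fun P V hV => hψ P _ fun v hv => ?_⟩
    by_cases hva : v = a
    · subst hva
      simp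
    · simpa [hva] using hV v (by simp [hva, hv])

/-- Image-finiteness is inherited by derivatives. -/
theorem ImageFiniteProc.of_trans {D Var Act PN : Type} [DecidableEq Var]
    {spec : PN → PExp D Var Act PN} {γ : CommFun Act} {P P' : PExp D Var Act PN}
    {V V' : Valuation D Var} {l : Label D Var Act} (hP : ImageFiniteProc spec γ P)
    (h : Trans spec γ P V l P' V') : ImageFiniteProc spec γ P' :=
  fun P'' hr => hP P'' (Relation.ReflTransGen.head ⟨V, l, V', h⟩ hr)

/-- A process and a valuation that are not matched by the state `s` up to logical equivalence
under all valuations are separated from `s` by a formula. -/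
theorem HMLcs.exists_distinguishing {D Var Pr L : Type} [DecidableEq Var] [Finite Var]
    (tr : (Pr × Valuation D Var) → L → (Pr × Valuation D Var) → Prop)
    (P : Pr) (V : Valuation D Var) (s : Pr × Valuation D Var)
    (hs : s.2 = V → ¬ ∀ (W : Valuation D Var) (φ : HMLcs D Var L),
      HMLcs.Sat tr φ (P, W) ↔ HMLcs.Sat tr φ (s.1, W)) :
    ∃ φ : HMLcs D Var L, HMLcs.Sat tr φ (P, V) ∧ ¬ HMLcs.Sat tr φ s := by
  obtain ⟨Q, U⟩ := s
  by_cases hV : U = V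
  · obtain ⟨W, hW⟩ := not_forall.mp (hs hV)
    obtain ⟨φ, hφ⟩ := not_forall.mp hW
    obtain ⟨ψ, hψ⟩ := HMLcs.exists_setAll tr W φ
    by_cases hP : HMLcs.Sat tr φ (P, W)
    · exact ⟨ψ, (hψ P V).mpr hP, fun hQ => hφ (iff_of_true hP ((hψ Q U).mp hQ))⟩
    · refine ⟨.neg ψ, fun h => hP ((hψ P V).mp h), fun hQ => hQ ((hψ Q U).mpr ?_)⟩
      by_contra hQ'
      exact hφ (iff_of_false hP hQ')
  · obtain ⟨v, hv⟩ := Function.ne_iff.mp hV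
    exact ⟨.check v (V v), rfl, hv⟩

/-- Transfer property: if `Q` has finitely many `l`-derivatives under `V` and agrees logically
with `P` under `V`, then every transition of `P` is matched by one of `Q`, up to logical
equivalence under all valuations. -/
theorem HMLcs.exists_matching_trans {D Var Act PN : Type} [DecidableEq Var] [Finite Var]
    {spec : PN → PExp D Var Act PN} {γ : CommFun Act} {P Q P' : PExp D Var Act PN}
    {V V' : Valuation D Var} {l : Label D Var Act}
    (hQ : ImageFiniteState (STrans spec γ) (Q, V))
    (hPQ : ∀ φ : HMLcs D Var (Label D Var Act),
      HMLcs.Sat (STrans spec γ) φ (P, V) → HMLcs.Sat (STrans spec γ) φ (Q, V))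
    (h : Trans spec γ P V l P' V') :
    ∃ Q', Trans spec γ Q V l Q' V' ∧
      ∀ (W : Valuation D Var) (φ : HMLcs D Var (Label D Var Act)),
        HMLcs.Sat (STrans spec γ) φ (P', W) ↔ HMLcs.Sat (STrans spec γ) φ (Q', W) := by
  by_contra! hcon
  have hdist : ∀ s : GState D Var Act PN, ∃ φ : HMLcs D Var (Label D Var Act),
      STrans spec γ (Q, V) l s →
        HMLcs.Sat (STrans spec γ) φ (P', V') ∧ ¬ HMLcs.Sat (STrans spec γ) φ s := by
    intro s
    by_cases hs : STrans spec γ (Q, V) l s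
    · obtain ⟨φ, hφ⟩ := HMLcs.exists_distinguishing (L := Label D Var Act) (STrans spec γ) P' V' s
        (by
          rintro rfl hall
          obtain ⟨W, φ, hφ⟩ := hcon s.1 hs
          have := hall W φ
          tauto)
      exact ⟨φ, fun _ => hφ⟩
    · exact ⟨.tt, fun h' => absurd h' hs⟩
  choose φ hφ using hdist
  obtain ⟨ψ, hψ⟩ := HMLcs.exists_conj (STrans spec γ) φ (hQ l)
  obtain ⟨l', hl', s, hs, hsat⟩ :=
    hPQ (.dia {l} (Set.finite_singleton _) (Set.singleton_nonempty _) ψ)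
      ⟨l, rfl, (P', V'), h, (hψ _).mpr fun s hs => (hφ s hs).1⟩
  obtain rfl := Set.mem_singleton_iff.mp hl'
  exact (hφ s hs).2 ((hψ s).mp hsat s hs)

/-- The relation relating process expressions satisfying the same `HML^{check+set}`
formulas under every valuation, restricted to image-finite process expressions, is a
stateless bisimulation; consequently, image-finite process expressions satisfying the
same `HML^{check+set}` formulas under every valuation are stateless bisimilar. -/
theorem statement3 {D Var Act PN : Type} [DecidableEq Var] [Finite Var]
    (spec : PN → PExp D Var Act PN) (hspec : Guarded spec)
    (γ : CommFun Act) (hγc : CommFun.Commutative γ) (hγa : CommFun.Associative γ)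
    (hγh : CommFun.Handshaking γ) :
    IsStatelessBisim spec γ (fun T U =>
      ImageFiniteProc spec γ T ∧ ImageFiniteProc spec γ U ∧
        ∀ (V : Valuation D Var) (φ : HMLcs D Var (Label D Var Act)),
          HMLcs.Sat (STrans spec γ) φ (T, V) ↔ HMLcs.Sat (STrans spec γ) φ (U, V)) ∧
    ∀ P Q : PExp D Var Act PN, ImageFiniteProc spec γ P → ImageFiniteProc spec γ Q →
      (∀ (V : Valuation D Var) (φ : HMLcs D Var (Label D Var Act)),
        HMLcs.Sat (STrans spec γ) φ (P, V) ↔ HMLcs.Sat (STrans spec γ) φ (Q, V)) →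
      StatelessBisimilar spec γ P Q := by
  have hbisim : IsStatelessBisim spec γ (fun T U =>
      ImageFiniteProc spec γ T ∧ ImageFiniteProc spec γ U ∧
        ∀ (V : Valuation D Var) (φ : HMLcs D Var (Label D Var Act)),
          HMLcs.Sat (STrans spec γ) φ (T, V) ↔ HMLcs.Sat (STrans spec γ) φ (U, V)) := by
    rintro T U ⟨hT, hU, hTU⟩ l V V'
    constructor
    · intro T' h
      obtain ⟨U', h', heq⟩ := HMLcs.exists_matching_trans (hU U .refl V)
        (fun φ => (hTU V φ).mp) h
      exact ⟨U', h', hT.of_trans h, hU.of_trans h', heq⟩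
    · intro U' h
      obtain ⟨T', h', heq⟩ := HMLcs.exists_matching_trans (hT T .refl V)
        (fun φ => (hTU V φ).mpr) h
      exact ⟨T', h', hT.of_trans h', hU.of_trans h, fun W φ => (heq W φ).symm⟩
  exact ⟨hbisim, fun P Q hP hQ h => ⟨_, hbisim, hP, hQ, h⟩⟩

end GlobalVars
end

section
/- Let ⟨P,V⟩ and ⟨Q,V⟩ be states of the process algebra with global variables (with the same valuation V) such that all states reachable from ⟨P,V⟩ and from ⟨Q,V⟩ are image-finite. Then ⟨P,V⟩ and ⟨Q,V⟩ are state-based bisimilar if and only if for all HML^{check} formulas φ, ⟨P,V⟩ satisfies φ if and only if ⟨Q,V⟩ satisfies φ. -/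
namespace GlobalVars

open scoped Classical

variable {D Var Act PN : Type}

/-- Two states are logically equivalent if they satisfy the same `HML^{check}` formulas. -/
def HMLc.Equiv {Pr L : Type}
    (tr : (Pr × Valuation D Var) → L → (Pr × Valuation D Var) → Prop)
    (s t : Pr × Valuation D Var) : Prop :=
  ∀ φ : HMLc D Var L, HMLc.Sat tr φ s ↔ HMLc.Sat tr φ t

theorem HMLc.Equiv.symm {Pr L : Type}
    {tr : (Pr × Valuation D Var) → L → (Pr × Valuation D Var) → Prop}
    {s t : Pr × Valuation D Var} (h : HMLc.Equiv tr s t) : HMLc.Equiv tr t s :=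
  fun φ => (h φ).symm

theorem HMLc.Equiv.valuation_eq {Pr L : Type}
    {tr : (Pr × Valuation D Var) → L → (Pr × Valuation D Var) → Prop}
    {s t : Pr × Valuation D Var} (h : HMLc.Equiv tr s t) : s.2 = t.2 :=
  funext fun v => ((h (.check v (s.2 v))).1 rfl).symm

/-- States that are not logically equivalent are told apart by a formula true in the first. -/
theorem HMLc.exists_sat_not_sat {Pr L : Type}
    {tr : (Pr × Valuation D Var) → L → (Pr × Valuation D Var) → Prop}
    {s t : Pr × Valuation D Var} (h : ¬ HMLc.Equiv tr s t) :
    ∃ φ : HMLc D Var L, HMLc.Sat tr φ s ∧ ¬ HMLc.Sat tr φ t := by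
  obtain ⟨φ, hφ⟩ := not_forall.1 h
  by_cases hs : HMLc.Sat tr φ s
  · exact ⟨φ, hs, fun ht => hφ (iff_of_true hs ht)⟩
  · exact ⟨.neg φ, hs, fun ht => hφ (iff_of_false hs ht)⟩

/-- A single formula tells a state apart from all states of a finite set none of which is
logically equivalent to it. -/
theorem HMLc.exists_sat_forall_not_sat {Pr L : Type}
    {tr : (Pr × Valuation D Var) → L → (Pr × Valuation D Var) → Prop}
    {s : Pr × Valuation D Var} {A : Set (Pr × Valuation D Var)} (hA : A.Finite)
    (h : ∀ t ∈ A, ¬ HMLc.Equiv tr s t) :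
    ∃ φ : HMLc D Var L, HMLc.Sat tr φ s ∧ ∀ t ∈ A, ¬ HMLc.Sat tr φ t := by
  induction A, hA using Set.Finite.induction_on with
  | empty => exact ⟨.tt, trivial, fun _ ht => ht.elim⟩
  | insert _ _ ih =>
    obtain ⟨φ, hs, hφ⟩ := ih fun t ht => h t (Set.mem_insert_of_mem _ ht)
    obtain ⟨ψ, hs', hψ⟩ := HMLc.exists_sat_not_sat (h _ (Set.mem_insert _ _))
    refine ⟨.conj ψ φ, ⟨hs', hs⟩, fun t ht hsat => ?_⟩
    rcases ht with rfl | ht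
    · exact hψ hsat.1
    · exact hφ t ht hsat.2

/-- Logical equivalence has the transfer property towards image-finite states. -/
theorem HMLc.Equiv.exists_trans {Pr L : Type}
    {tr : (Pr × Valuation D Var) → L → (Pr × Valuation D Var) → Prop}
    {s t s' : Pr × Valuation D Var} {l : L} (h : HMLc.Equiv tr s t)
    (ht : ImageFiniteState tr t) (hs' : tr s l s') :
    ∃ t', tr t l t' ∧ HMLc.Equiv tr s' t' := by
  by_contra! hne
  obtain ⟨φ, hsφ, hφ⟩ := HMLc.exists_sat_forall_not_sat (ht l) hne
  obtain ⟨l', rfl, t', htt', htφ⟩ :=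
    (h (.dia {l} (Set.finite_singleton _) (Set.singleton_nonempty _) φ)).1
      ⟨l, rfl, s', hs', hsφ⟩
  exact hφ t' htt' htφ

/-- States related by a state-based bisimulation are logically equivalent. -/
theorem IsStateBasedBisim.equiv [DecidableEq Var] {spec : PN → PExp D Var Act PN}
    {γ : CommFun Act} {R : GState D Var Act PN → GState D Var Act PN → Prop}
    (hR : IsStateBasedBisim spec γ R) {s t : GState D Var Act PN} (hst : R s t) :
    HMLc.Equiv (STrans spec γ) s t := by
  intro φ
  have forth : ∀ {s t : GState D Var Act PN}, R s t → ∀ {l s'}, STrans spec γ s l s' →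
      ∃ t', STrans spec γ t l t' ∧ R s' t' := fun {s t} h {l s'} hs =>
    let ⟨Q', hQ, hRQ⟩ := ((hR s.1 s.2 t.1 t.2 h).2 l s'.2).1 s'.1 hs
    ⟨(Q', s'.2), hQ, hRQ⟩
  have back : ∀ {s t : GState D Var Act PN}, R s t → ∀ {l t'}, STrans spec γ t l t' →
      ∃ s', STrans spec γ s l s' ∧ R s' t' := fun {s t} h {l t'} ht =>
    let ⟨P', hP, hRP⟩ := ((hR s.1 s.2 t.1 t.2 h).2 l t'.2).2 t'.1 ht
    ⟨(P', t'.2), hP, hRP⟩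
  induction φ generalizing s t with
  | tt => exact Iff.rfl
  | ff => exact Iff.rfl
  | check v e => simp only [HMLc.Sat, (hR s.1 s.2 t.1 t.2 hst).1]
  | neg φ ih => exact not_congr (ih hst)
  | conj φ ψ ihφ ihψ => exact and_congr (ihφ hst) (ihψ hst)
  | disj φ ψ ihφ ihψ => exact or_congr (ihφ hst) (ihψ hst)
  | dia T _ _ φ ih =>
    constructor
    · rintro ⟨l, hl, s', hs, hφ⟩
      obtain ⟨t', ht, hR'⟩ := forth hst hs
      exact ⟨l, hl, t', ht, (ih hR').1 hφ⟩
    · rintro ⟨l, hl, t', ht, hφ⟩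
      obtain ⟨s', hs, hR'⟩ := back hst ht
      exact ⟨l, hl, s', hs, (ih hR').2 hφ⟩
  | box T _ _ φ ih =>
    constructor
    · intro h l hl t' ht
      obtain ⟨s', hs, hR'⟩ := back hst ht
      exact (ih hR').1 (h l hl s' hs)
    · intro h l hl s' hs
      obtain ⟨t', ht, hR'⟩ := forth hst hs
      exact (ih hR').2 (h l hl t' ht)

/-- Logical equivalence is a state-based bisimulation on the states reachable from two states
all of whose reachable states are image-finite. -/
theorem isStateBasedBisim_equiv [DecidableEq Var] {spec : PN → PExp D Var Act PN}
    {γ : CommFun Act} {s₀ t₀ : GState D Var Act PN}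
    (hs₀ : ∀ s, ReachableState (STrans spec γ) s₀ s → ImageFiniteState (STrans spec γ) s)
    (ht₀ : ∀ t, ReachableState (STrans spec γ) t₀ t → ImageFiniteState (STrans spec γ) t) :
    IsStateBasedBisim spec γ fun s t => ReachableState (STrans spec γ) s₀ s ∧
      ReachableState (STrans spec γ) t₀ t ∧ HMLc.Equiv (STrans spec γ) s t := by
  rintro P V₁ Q V₂ ⟨hs, ht, h⟩
  refine ⟨h.valuation_eq, fun l V' => ⟨fun P' hP' => ?_, fun Q' hQ' => ?_⟩⟩
  · obtain ⟨⟨Q', W⟩, hQ', h'⟩ := h.exists_trans (s' := (P', V')) (ht₀ _ ht) hP'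
    obtain rfl : V' = W := h'.valuation_eq
    exact ⟨Q', hQ', hs.tail ⟨l, hP'⟩, ht.tail ⟨l, hQ'⟩, h'⟩
  · obtain ⟨⟨P', W⟩, hP', h'⟩ := h.symm.exists_trans (s' := (Q', V')) (hs₀ _ hs) hQ'
    obtain rfl : V' = W := h'.valuation_eq
    exact ⟨P', hP', hs.tail ⟨l, hP'⟩, ht.tail ⟨l, hQ'⟩, h'.symm⟩

/-- Theorem 2: for states `⟨P,V⟩` and `⟨Q,V⟩` all of whose reachable states are
image-finite, `⟨P,V⟩` and `⟨Q,V⟩` are state-based bisimilar iff they satisfy the same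
`HML^{check}` formulas. -/
theorem statement4 {D Var Act PN : Type} [DecidableEq Var] [Finite Var]
    (spec : PN → PExp D Var Act PN) (hspec : Guarded spec)
    (γ : CommFun Act) (hγc : CommFun.Commutative γ) (hγa : CommFun.Associative γ)
    (hγh : CommFun.Handshaking γ)
    (P Q : PExp D Var Act PN) (V : Valuation D Var)
    (hP : ∀ s, ReachableState (STrans spec γ) (P, V) s → ImageFiniteState (STrans spec γ) s)
    (hQ : ∀ s, ReachableState (STrans spec γ) (Q, V) s → ImageFiniteState (STrans spec γ) s) :
    StateBasedBisimilar spec γ (P, V) (Q, V) ↔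
      ∀ φ : HMLc D Var (Label D Var Act),
        HMLc.Sat (STrans spec γ) φ (P, V) ↔ HMLc.Sat (STrans spec γ) φ (Q, V) := by
  constructor
  · rintro ⟨R, hR, hPQ⟩
    exact hR.equiv hPQ
  · intro h
    exact ⟨_, isStateBasedBisim_equiv hP hQ, .refl, .refl, h⟩

end GlobalVars
end
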